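/- Assume the mastery hypotheses. Then for every s ∉ Abs, V*(s) equals the supremum of V̄*(s, g) over the set of goals g ∈ G that are reachable from s (this set is nonempty by properness). -/

import Mathlib

open Classical

/-- The state reached after `i` steps when starting in `s` and executing the actions in `as`
(deterministic transition function `T`). `stateAt T s as 0 = s` and
`stateAt T s as (i+1) = T (stateAt T s as i) (as[i])`. -/
def stateAt {S A : Type*} (T : S → A → S) (s : S) (as : List A) (i : ℕ) : S :=
  (as.take i).foldl T s

/-- `as` is a terminating trajectory from `s`: it is nonempty, the final induced state is
absorbing, and no earlier induced state is absorbing. -/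
def Terminating {S A : Type*} (T : S → A → S) (Abs : Set S) (s : S) (as : List A) : Prop :=
  as ≠ [] ∧ stateAt T s as as.length ∈ Abs ∧ ∀ i < as.length, stateAt T s as i ∉ Abs

/-- The achieved goal of a trajectory: the state from which the terminal transition is taken. -/
def achievedGoal {S A : Type*} (T : S → A → S) (s : S) (as : List A) : S :=
  stateAt T s as (as.length - 1)

/-- The return of a trajectory under reward function `R`: the sum of the one-step rewards. -/
def ret {S A : Type*} (T : S → A → S) (R : S → A → S → ℝ) : S → List A → ℝ
  | _, [] => 0
  | s, a :: as => R s a (T s a) + ret T R (T s a) as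

/-- The internal goal set: all states from which some action leads to an absorbing state. -/
def goalSet {S A : Type*} (T : S → A → S) (Abs : Set S) : Set S :=
  {s | ∃ a : A, T s a ∈ Abs}

/-- The goal-oriented reward: a penalty `rbMIN` for terminal transitions taken from a state
other than the goal `g`, and the task reward `R` otherwise. -/
noncomputable def Rbar {S A : Type*} (Abs : Set S) (rbMIN : ℝ) (R : S → A → S → ℝ) (g : S) :
    S → A → S → ℝ :=
  fun s a s' => if s ≠ g ∧ s' ∈ Abs then rbMIN else R s a s'

/-- The optimal value `Q*(s, a)`: the supremum of returns under `R` over terminating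
trajectories from `s` whose first action is `a`. -/
noncomputable def Qstar {S A : Type*} (T : S → A → S) (Abs : Set S) (R : S → A → S → ℝ)
    (s : S) (a : A) : ℝ :=
  sSup {x | ∃ as : List A, Terminating T Abs s as ∧ as.head? = some a ∧ ret T R s as = x}

/-- The optimal state value `V*(s) = sup_a Q*(s, a)`. -/
noncomputable def Vstar {S A : Type*} (T : S → A → S) (Abs : Set S) (R : S → A → S → ℝ)
    (s : S) : ℝ :=
  sSup (Set.range (Qstar T Abs R s))

/-- The optimal world value `Q̄*(s, g, a)`: the optimal value for the goal-oriented reward. -/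
noncomputable def Qbar {S A : Type*} (T : S → A → S) (Abs : Set S) (rbMIN : ℝ)
    (R : S → A → S → ℝ) (s g : S) (a : A) : ℝ :=
  Qstar T Abs (Rbar Abs rbMIN R g) s a

/-- The optimal world state value `V̄*(s, g) = sup_a Q̄*(s, g, a)`. -/
noncomputable def Vbar {S A : Type*} (T : S → A → S) (Abs : Set S) (rbMIN : ℝ)
    (R : S → A → S → ℝ) (s g : S) : ℝ :=
  sSup (Set.range (Qbar T Abs rbMIN R s g))

/-- The environment is proper with horizon `D`: from every non-absorbing state some
terminating trajectory exists, and every terminating trajectory has length at most `D`. -/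
def Proper {S A : Type*} (T : S → A → S) (Abs : Set S) (D : ℕ) : Prop :=
  1 ≤ D ∧ (∀ s ∉ Abs, ∃ as : List A, Terminating T Abs s as) ∧
    ∀ (s : S) (as : List A), Terminating T Abs s as → as.length ≤ D

/-- `g` is reachable from `s`: some terminating trajectory from `s` has achieved goal `g`. -/
def Reachable {S A : Type*} (T : S → A → S) (Abs : Set S) (s g : S) : Prop :=
  ∃ as : List A, Terminating T Abs s as ∧ achievedGoal T s as = g

/-- The optimal terminal reward at a goal state `g`: the supremum of `R(g, a, T(g, a))`
over actions `a` whose transition from `g` is terminal. -/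
noncomputable def Rterm {S A : Type*} (T : S → A → S) (Abs : Set S) (R : S → A → S → ℝ)
    (g : S) : ℝ :=
  sSup {x | ∃ a : A, T g a ∈ Abs ∧ R g a (T g a) = x}

theorem terminating_cons {S A : Type*} (T : S → A → S) (Abs : Set S) (s : S) (a : A)
    (as : List A) : Terminating T Abs s (a :: as) ↔
      s ∉ Abs ∧ ((as = [] ∧ T s a ∈ Abs) ∨ Terminating T Abs (T s a) as) := by
  unfold Terminating
  constructor
  · rintro ⟨-, h2, h3⟩
    refine ⟨by simpa [stateAt] using h3 0 (by simp), ?_⟩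
    by_cases has : as = []
    · subst has
      left
      exact ⟨rfl, by simpa [stateAt] using h2⟩
    · right
      refine ⟨has, by simpa [stateAt] using h2, fun i hi => ?_⟩
      simpa [stateAt] using h3 (i + 1) (by simpa using hi)
  · rintro ⟨h0, ⟨rfl, h⟩ | ⟨h1, h2, h3⟩⟩
    · refine ⟨by simp, by simpa [stateAt] using h, fun i hi => ?_⟩
      have : i = 0 := by simpa using hi
      subst this
      simpa [stateAt] using h0
    · refine ⟨by simp, by simpa [stateAt] using h2, fun i hi => ?_⟩
      cases i with
      | zero => simpa [stateAt] using h0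
      | succ i => simpa [stateAt] using h3 i (by simpa using hi)

theorem terminating_not_nil {S A : Type*} {T : S → A → S} {Abs : Set S} {s : S}
    (h : Terminating T Abs s []) : False := h.1 rfl

theorem terminating_start {S A : Type*} {T : S → A → S} {Abs : Set S} {s : S} {as : List A}
    (h : Terminating T Abs s as) : s ∉ Abs := by
  cases as with
  | nil => exact (terminating_not_nil h).elim
  | cons a as => exact ((terminating_cons T Abs s a as).1 h).1

theorem achievedGoal_cons {S A : Type*} (T : S → A → S) (s : S) (a : A)
    (as : List A) (h : as ≠ []) : achievedGoal T s (a :: as) = achievedGoal T (T s a) as := by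
  cases as with
  | nil => exact (h rfl).elim
  | cons b bs => simp [achievedGoal, stateAt]

theorem achievedGoal_mem {S A : Type*} (T : S → A → S) (Abs : Set S) (as : List A) :
    ∀ s, Terminating T Abs s as → achievedGoal T s as ∈ goalSet T Abs := by
  induction as with
  | nil => intro s h; exact (terminating_not_nil h).elim
  | cons a as ih =>
    intro s h
    obtain ⟨h0, ⟨rfl, h'⟩ | h⟩ := (terminating_cons T Abs s a as).1 h
    · exact ⟨a, by simpa [achievedGoal, stateAt] using h'⟩
    · rw [achievedGoal_cons T s a as h.1]
      exact ih _ h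

theorem ret_Rbar_achieved {S A : Type*} (T : S → A → S) (Abs : Set S) (rb : ℝ)
    (R : S → A → S → ℝ) (as : List A) :
    ∀ s, Terminating T Abs s as →
      ret T (Rbar Abs rb R (achievedGoal T s as)) s as = ret T R s as := by
  induction as with
  | nil => intro s h; exact (terminating_not_nil h).elim
  | cons a as ih =>
    intro s h
    obtain ⟨h0, ⟨rfl, h'⟩ | h⟩ := (terminating_cons T Abs s a as).1 h
    · simp [ret, Rbar, achievedGoal, stateAt]
    · rw [achievedGoal_cons T s a as h.1]
      simp only [ret]
      rw [ih _ h]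
      simp [Rbar, terminating_start h]

theorem ret_mono {S A : Type*} (T : S → A → S) (Abs : Set S)
    (R R' : S → A → S → ℝ) (hR : ∀ s ∉ Abs, ∀ a, R s a (T s a) ≤ R' s a (T s a))
    (as : List A) : ∀ s, Terminating T Abs s as → ret T R s as ≤ ret T R' s as := by
  induction as with
  | nil => intro s h; exact (terminating_not_nil h).elim
  | cons a as ih =>
    intro s h
    obtain ⟨h0, ⟨rfl, h'⟩ | h⟩ := (terminating_cons T Abs s a as).1 h
    · simpa [ret] using hR s h0 a
    · simpa only [ret] using add_le_add (hR s h0 a) (ih _ h)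

theorem ret_const {S A : Type*} (T : S → A → S) (c : ℝ) (as : List A) :
    ∀ s, ret T (fun _ _ _ => c) s as = as.length * c := by
  induction as with
  | nil => intro s; simp [ret]
  | cons a as ih => intro s; simp only [ret, ih, List.length_cons]; push_cast; ring

theorem exists_terminating_head {S A : Type*} {T : S → A → S} {Abs : Set S} {D : ℕ}
    (hP : Proper T Abs D) (s : S) (hs : s ∉ Abs) (a : A) :
    ∃ as, Terminating T Abs s as ∧ as.head? = some a := by
  by_cases h : T s a ∈ Abs
  · exact ⟨[a], (terminating_cons T Abs s a []).2 ⟨hs, Or.inl ⟨rfl, h⟩⟩, rfl⟩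
  · obtain ⟨as, has⟩ := hP.2.1 _ h
    exact ⟨a :: as, (terminating_cons T Abs s a as).2 ⟨hs, Or.inr has⟩, rfl⟩

theorem Qstar_le {S A : Type*} {T : S → A → S} {Abs : Set S} {D : ℕ}
    (hP : Proper T Abs D) (R : S → A → S → ℝ) (s : S) (hs : s ∉ Abs) (B : ℝ)
    (hB : ∀ as, Terminating T Abs s as → ret T R s as ≤ B) (a : A) :
    Qstar T Abs R s a ≤ B := by
  obtain ⟨as, h1, h2⟩ := exists_terminating_head hP s hs a
  refine csSup_le ⟨_, as, h1, h2, rfl⟩ ?_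
  rintro _ ⟨bs, h, -, rfl⟩
  exact hB bs h

theorem Vstar_le {S A : Type*} {T : S → A → S} {Abs : Set S} {D : ℕ}
    (hP : Proper T Abs D) (R : S → A → S → ℝ) (s : S) (hs : s ∉ Abs) (B : ℝ)
    (hB : ∀ as, Terminating T Abs s as → ret T R s as ≤ B) :
    Vstar T Abs R s ≤ B := by
  obtain ⟨as, has⟩ := hP.2.1 s hs
  cases as with
  | nil => exact (terminating_not_nil has).elim
  | cons a as =>
    refine csSup_le ⟨_, a, rfl⟩ ?_
    rintro _ ⟨b, rfl⟩
    exact Qstar_le hP R s hs B hB b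

theorem le_Vstar {S A : Type*} {T : S → A → S} {Abs : Set S} {D : ℕ}
    (hP : Proper T Abs D) (R : S → A → S → ℝ) (s : S) (hs : s ∉ Abs) (B : ℝ)
    (hB : ∀ as, Terminating T Abs s as → ret T R s as ≤ B)
    (as : List A) (has : Terminating T Abs s as) :
    ret T R s as ≤ Vstar T Abs R s := by
  cases as with
  | nil => exact (terminating_not_nil has).elim
  | cons a as =>
    have h1 : ret T R s (a :: as) ≤ Qstar T Abs R s a := by
      refine le_csSup ⟨B, ?_⟩ ⟨a :: as, has, rfl, rfl⟩
      rintro _ ⟨bs, h, -, rfl⟩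
      exact hB bs h
    refine h1.trans (le_csSup ⟨B, ?_⟩ ⟨a, rfl⟩)
    rintro _ ⟨b, rfl⟩
    exact Qstar_le hP R s hs B hB b

/-- Theorem 1(ii) combined with the mastery value bounds: under the mastery hypotheses, for
every `s ∉ Abs`, `V*(s)` equals the supremum of `V̄*(s, g)` over goals `g ∈ G` that are
reachable from `s`. -/
theorem vstar_eq_sup_vbar_reachable {S A : Type*} (T : S → A → S) (Abs : Set S)
    (R : S → A → S → ℝ) (rMIN rMAX rbMIN : ℝ) (D : ℕ)
    (hProper : Proper T Abs D)
    (hbound : ∀ s ∉ Abs, ∀ a : A, rMIN ≤ R s a (T s a) ∧ R s a (T s a) < rMAX)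
    (hrMIN : rMIN ≤ 0) (hrMAX : 0 < rMAX)
    (hrb : rbMIN = (rMIN - rMAX) * D) :
    ∀ s ∉ Abs,
      Vstar T Abs R s =
        sSup {x | ∃ g ∈ goalSet T Abs, Reachable T Abs s g ∧
          Vbar T Abs rbMIN R s g = x} := by
  intro s hs
  have hD : (1 : ℝ) ≤ D := by exact_mod_cast hProper.1
  have hrb' : rbMIN ≤ rMIN := by rw [hrb]; nlinarith
  have hB : ∀ as, Terminating T Abs s as → ret T R s as ≤ D * rMAX := by
    intro as has
    have h1 := ret_mono T Abs R (fun _ _ _ => rMAX) (fun s hs a => (hbound s hs a).2.le) as s has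
    rw [ret_const] at h1
    have h2 : (as.length : ℝ) ≤ D := by exact_mod_cast hProper.2.2 s as has
    exact h1.trans (mul_le_mul_of_nonneg_right h2 hrMAX.le)
  have hle : ∀ g as, Terminating T Abs s as →
      ret T (Rbar Abs rbMIN R g) s as ≤ ret T R s as := by
    intro g as has
    refine ret_mono T Abs _ _ (fun t ht a => ?_) as s has
    unfold Rbar
    split_ifs
    · exact hrb'.trans (hbound t ht a).1
    · exact le_rfl
  have hVV : ∀ g, Vbar T Abs rbMIN R s g = Vstar T Abs (Rbar Abs rbMIN R g) s := fun _ => rfl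
  have hVle : ∀ g, Vbar T Abs rbMIN R s g ≤ Vstar T Abs R s := by
    intro g
    rw [hVV]
    exact Vstar_le hProper _ s hs _ fun as has =>
      (hle g as has).trans (le_Vstar hProper R s hs _ hB as has)
  apply le_antisymm
  · refine Vstar_le hProper R s hs _ fun as has => ?_
    rw [← ret_Rbar_achieved T Abs rbMIN R as s has]
    refine (le_Vstar hProper _ s hs (D * rMAX)
      (fun bs hbs => (hle _ bs hbs).trans (hB bs hbs)) as has).trans ?_
    refine le_csSup ⟨Vstar T Abs R s, ?_⟩
      ⟨_, achievedGoal_mem T Abs as s has, ⟨as, has, rfl⟩, rfl⟩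
    rintro _ ⟨g, -, -, rfl⟩
    exact hVle g
  · obtain ⟨as, has⟩ := hProper.2.1 s hs
    refine csSup_le ⟨_, _, achievedGoal_mem T Abs as s has, ⟨as, has, rfl⟩, rfl⟩ ?_
    rintro _ ⟨g, -, -, rfl⟩
    exact hVle g
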